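/- Let t ≥ 1 be an integer, n = 2^{2t+1} + 1, and β a primitive n-th root of unity in GF(4^{2t+1}). Let m_i(x) denote the minimal polynomial of β^i over GF(4) and let C be the cyclic code of length n over GF(4) with generator polynomial g(x) = lcm(m_0(x), m_1(x), m_2(x)). Then C is a Hermitian LCD code over GF(4), its dimension equals 2^{2t+1} − 4t − 2, and its minimum distance is at least 6. -/

import Mathlib

open Polynomial

noncomputable section

/-- The cyclic shift of a vector: `(c₀,…,c_{n−1}) ↦ (c_{n−1},c₀,…,c_{n−2})`. -/
def cyclicShift {F : Type*} {n : ℕ} (c : Fin n → F) : Fin n → F :=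
  fun i => c ⟨(i.val + (n - 1)) % n, Nat.mod_lt _ i.pos⟩

/-- A linear code (submodule of `F^n`) is cyclic if it is stable under the cyclic shift. -/
def IsCyclicCode {F : Type*} [Field F] {n : ℕ} (C : Submodule F (Fin n → F)) : Prop :=
  ∀ c ∈ C, cyclicShift c ∈ C

/-- The Hermitian dual `C^⊥H = {b : ∑ i, b i * (c i)^q = 0 for all c ∈ C}`. -/
def hermDualSet {F : Type*} [Field F] (q : ℕ) {n : ℕ} (C : Set (Fin n → F)) :
    Set (Fin n → F) :=
  {b | ∀ c ∈ C, ∑ i, b i * (c i) ^ q = 0}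

/-- A code is Hermitian LCD if `C ∩ C^⊥H = {0}`. -/
def IsHermitianLCD {F : Type*} [Field F] (q : ℕ) {n : ℕ} (C : Set (Fin n → F)) : Prop :=
  C ∩ hermDualSet q C = {0}

/-- The polynomial `c₀ + c₁ x + ⋯ + c_{n−1} x^{n−1}` associated with a vector. -/
def polyOfVec {F : Type*} [Field F] {n : ℕ} (c : Fin n → F) : Polynomial F :=
  ∑ i : Fin n, Polynomial.C (c i) * Polynomial.X ^ (i : ℕ)

/-- The cyclic code of length `n` with generator polynomial `g` (for `g ∣ xⁿ − 1`):
vectors whose associated polynomial (of degree `< n`) is divisible by `g`. -/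
def cyclicCodeOf {F : Type*} [Field F] (n : ℕ) (g : Polynomial F) :
    Submodule F (Fin n → F) where
  carrier := {c | g ∣ polyOfVec c}
  add_mem' := by
    intro a b ha hb
    have h : polyOfVec (a + b) = polyOfVec a + polyOfVec b := by
      simp [polyOfVec, add_mul, Finset.sum_add_distrib]
    simpa [Set.mem_setOf_eq, h] using dvd_add ha hb
  zero_mem' := by simp [polyOfVec]
  smul_mem' := by
    intro r c hc
    have h : polyOfVec (r • c) = Polynomial.C r * polyOfVec c := by
      simp [polyOfVec, Finset.mul_sum, mul_assoc]
    simpa [Set.mem_setOf_eq, h] using hc.mul_left (Polynomial.C r)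

/-- `f̄`: the polynomial obtained by raising every coefficient of `f` to the `q`-th power. -/
def conjPoly {F : Type*} [Field F] (q : ℕ) (f : Polynomial F) : Polynomial F :=
  f.sum fun i a => Polynomial.C (a ^ q) * Polynomial.X ^ i

/-- The reciprocal polynomial `f*(x) = f₀⁻¹ xᵗ f(1/x)`. -/
def recipPoly {F : Type*} [Field F] (f : Polynomial F) : Polynomial F :=
  Polynomial.C (f.coeff 0)⁻¹ * f.reverse

/-- The `Q`-cyclotomic coset of `s` modulo `n`, as a subset of `{0,…,n−1} ⊆ ℕ`
(`s` is taken as an integer so that negative indices are allowed). -/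
def cycCoset (Q n : ℕ) (s : ℤ) : Set ℕ :=
  {x | x < n ∧ ∃ j : ℕ, (x : ℤ) ≡ s * (Q : ℤ) ^ j [ZMOD n]}

end

section CyclicCode

variable {F : Type*} [Field F] {E : Type*} [Field E] [Algebra F E]

lemma aeval_polyOfVec {n : ℕ} (c : Fin n → F) (x : E) :
    aeval x (polyOfVec c) = ∑ i, algebraMap F E (c i) * x ^ (i : ℕ) := by
  simp [polyOfVec]

lemma coeff_polyOfVec {n : ℕ} (c : Fin n → F) (i : Fin n) : (polyOfVec c).coeff i = c i := by
  simp [polyOfVec, coeff_C_mul, coeff_X_pow, Fin.val_inj]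

lemma degree_polyOfVec_lt {n : ℕ} (c : Fin n → F) : (polyOfVec c).degree < n := by
  refine (degree_sum_le _ _).trans_lt ((Finset.sup_lt_iff (WithBot.bot_lt_coe n)).2 fun i _ => ?_)
  exact (degree_C_mul_X_pow_le _ _).trans_lt (WithBot.coe_lt_coe.2 i.2)

lemma polyOfVec_eq_zero_iff {n : ℕ} (c : Fin n → F) : polyOfVec c = 0 ↔ c = 0 := by
  refine ⟨fun h => funext fun i => ?_, fun h => by simp [h, polyOfVec]⟩
  rw [← coeff_polyOfVec c i, h]; simp

lemma polyOfVec_coeff {n : ℕ} {p : F[X]} (hp : p.degree < n) :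
    polyOfVec (fun i : Fin n => p.coeff i) = p := by
  ext k
  by_cases hk : k < n
  · exact coeff_polyOfVec (fun i : Fin n => p.coeff i) ⟨k, hk⟩
  · have hk' : (n : WithBot ℕ) ≤ k := by exact_mod_cast not_lt.1 hk
    rw [coeff_eq_zero_of_degree_lt (hp.trans_le hk'),
      coeff_eq_zero_of_degree_lt ((degree_polyOfVec_lt _).trans_le hk')]

/-- `polyOfVec` as a linear map. -/
noncomputable def polyOfVecHom (F : Type*) [Field F] (n : ℕ) : (Fin n → F) →ₗ[F] F[X] where
  toFun := polyOfVec
  map_add' a b := by simp [polyOfVec, add_mul, Finset.sum_add_distrib]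
  map_smul' r c := by simp [polyOfVec, Finset.mul_sum, mul_assoc, smul_eq_C_mul]

lemma finrank_cyclicCodeOf_add_natDegree {n : ℕ} {g : F[X]} (hg : g.Monic)
    (hgn : g.natDegree ≤ n) :
    Module.finrank F (cyclicCodeOf n g) + g.natDegree = n := by
  set φ : (Fin n → F) →ₗ[F] AdjoinRoot g :=
    (AdjoinRoot.mkₐ g).toLinearMap ∘ₗ polyOfVecHom F n with hφ
  have hφa : ∀ c, φ c = AdjoinRoot.mk g (polyOfVec c) := fun c => rfl
  have hker : LinearMap.ker φ = cyclicCodeOf n g := by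
    ext c
    rw [LinearMap.mem_ker, hφa, AdjoinRoot.mk_eq_zero]
    rfl
  have hrange : LinearMap.range φ = ⊤ := by
    refine LinearMap.range_eq_top.2 fun y => ?_
    obtain ⟨p, rfl⟩ := AdjoinRoot.mk_surjective y
    have hdeg : (p %ₘ g).degree < n := by
      refine (degree_modByMonic_lt p hg).trans_le ?_
      exact degree_le_of_natDegree_le hgn
    refine ⟨fun i => (p %ₘ g).coeff i, ?_⟩
    rw [hφa, polyOfVec_coeff hdeg, AdjoinRoot.mk_eq_mk]
    exact ⟨-(p /ₘ g), by linear_combination modByMonic_add_div p g⟩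
  have h := φ.finrank_range_add_finrank_ker
  have hfin : Module.finrank F (AdjoinRoot g) = g.natDegree := by
    rw [(AdjoinRoot.powerBasis' hg).finrank, AdjoinRoot.powerBasis'_dim]
  rw [hker, hrange, finrank_top, hfin] at h
  simpa [add_comm] using h

/-- A word whose polynomial vanishes at all `n`-th roots of unity is zero. -/
lemma eq_zero_of_forall_aeval_pow_eq_zero {n : ℕ} (hn : 0 < n) {β : E} (hβ : IsPrimitiveRoot β n)
    (c : Fin n → F) (h : ∀ k < n, aeval (β ^ k) (polyOfVec c) = 0) : c = 0 := by
  rw [← polyOfVec_eq_zero_iff]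
  have hmap : (polyOfVec c).map (algebraMap F E) = 0 := by
    refine eq_zero_of_natDegree_lt_card_of_eval_eq_zero _
      (f := fun i : Fin n => β ^ (i : ℕ)) (fun i j hij => ?_) (fun i => ?_) ?_
    · exact Fin.ext (hβ.pow_inj i.2 j.2 hij)
    · rw [eval_map_algebraMap]; exact h i i.2
    · rw [natDegree_map, Fintype.card_fin]
      by_cases h0 : polyOfVec c = 0
      · simpa [h0] using hn
      · exact (natDegree_lt_iff_degree_lt h0).2 (degree_polyOfVec_lt c)
  exact (Polynomial.map_eq_zero _).1 hmap

lemma pow_val_sub_mul_pow_val {n : ℕ} [NeZero n] {x : E} (hx : x ^ n = 1) (i j : Fin n) :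
    x ^ ((i - j : Fin n) : ℕ) * x ^ (j : ℕ) = x ^ (i : ℕ) := by
  rw [← pow_add, pow_eq_pow_mod _ hx, ← Fin.val_add, sub_add_cancel]

lemma aeval_polyOfVec_sub {n : ℕ} [NeZero n] {x : E} (hx : x ^ n = 1) (c : Fin n → F)
    (s : Fin n) :
    aeval x (polyOfVec fun i => c (i - s)) = x ^ (s : ℕ) * aeval x (polyOfVec c) := by
  rw [aeval_polyOfVec, aeval_polyOfVec, Finset.mul_sum]
  refine Fintype.sum_equiv (Equiv.subRight s) _ _ fun i => ?_
  rw [← pow_val_sub_mul_pow_val hx i s]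
  simp only [Equiv.subRight_apply]
  ring

/-- A word that is Hermitian-orthogonal to all cyclic shifts of `c` satisfies a product relation
between its values and those of `c` at `n`-th roots of unity. -/
lemma aeval_mul_aeval_sq_eq_zero {n : ℕ} [NeZero n] [CharP E 2] {x γ : E} (hx : x ^ n = 1)
    (hxγ : x * γ ^ 2 = 1) (b c : Fin n → F)
    (h : ∀ s : Fin n, ∑ i, b i * c (i - s) ^ 2 = 0) :
    aeval x (polyOfVec b) * aeval γ (polyOfVec c) ^ 2 = 0 := by
  have hchar : ∀ i j : Fin n,
      x ^ ((i - j : Fin n) : ℕ) = x ^ (i : ℕ) * (γ ^ 2) ^ (j : ℕ) := fun i j => by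
    have := pow_val_sub_mul_pow_val hx i j
    calc x ^ ((i - j : Fin n) : ℕ)
        = x ^ ((i - j : Fin n) : ℕ) * (x * γ ^ 2) ^ (j : ℕ) := by rw [hxγ, one_pow, mul_one]
      _ = _ := by rw [mul_pow, ← mul_assoc, this]
  have : Fact (Nat.Prime 2) := ⟨Nat.prime_two⟩
  have hsq : aeval γ (polyOfVec c) ^ 2 =
      ∑ j, algebraMap F E (c j) ^ 2 * (γ ^ 2) ^ (j : ℕ) := by
    rw [aeval_polyOfVec, sum_pow_char]
    exact Finset.sum_congr rfl fun j _ => by ring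
  calc aeval x (polyOfVec b) * aeval γ (polyOfVec c) ^ 2
      = ∑ i, ∑ j, algebraMap F E (b i) * algebraMap F E (c j) ^ 2 *
          x ^ ((i - j : Fin n) : ℕ) := by
        rw [hsq, aeval_polyOfVec, Finset.sum_mul_sum]
        refine Finset.sum_congr rfl fun i _ => Finset.sum_congr rfl fun j _ => ?_
        rw [hchar]; ring
    _ = ∑ i, ∑ s, algebraMap F E (b i) * algebraMap F E (c (i - s)) ^ 2 * x ^ (s : ℕ) := by
        refine Finset.sum_congr rfl fun i _ => ?_
        refine Fintype.sum_equiv (Equiv.subLeft i) _ _ fun j => ?_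
        simp [Equiv.subLeft_apply]
    _ = ∑ s : Fin n, x ^ (s : ℕ) * algebraMap F E (∑ i, b i * c (i - s) ^ 2) := by
        rw [Finset.sum_comm]
        refine Finset.sum_congr rfl fun s _ => ?_
        rw [map_sum, Finset.mul_sum]
        refine Finset.sum_congr rfl fun i _ => ?_
        rw [map_mul, map_pow]; ring
    _ = 0 := by simp [h]

/-- A nonzero word whose polynomial vanishes at `1, β^{±1}, β^{±2}` has weight at least `6`. -/
lemma six_le_hammingNorm [DecidableEq F] {n : ℕ} {β : E} (hβ : IsPrimitiveRoot β n)
    {c : Fin n → F} (hc : c ≠ 0) {y : E} (hy : β ^ 2 * y = 1)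
    (h : ∀ l < 5, aeval (y * β ^ l) (polyOfVec c) = 0) : 6 ≤ hammingNorm c := by
  by_contra! hlt
  obtain ⟨i₀, hi₀⟩ := Function.ne_iff.1 hc
  set S : Finset (Fin n) := {i | c i ≠ 0} with hS
  have hi₀S : i₀ ∈ S := by simpa [hS] using hi₀
  have hcard : (S.erase i₀).card < 5 := by
    have h1 := Finset.card_erase_lt_of_mem hi₀S
    have h2 : S.card = hammingNorm c := rfl
    omega
  set P : E[X] := ∏ j ∈ S.erase i₀, (X - C (β ^ (j : ℕ))) with hP
  have hPdeg : P.natDegree < 5 := by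
    rw [hP, natDegree_finsetProd_X_sub_C_eq_card]; exact hcard
  have hsum : ∑ i, algebraMap F E (c i) * y ^ (i : ℕ) * P.eval (β ^ (i : ℕ)) = 0 := by
    simp_rw [eval_eq_sum_range' hPdeg, Finset.mul_sum]
    rw [Finset.sum_comm]
    refine Finset.sum_eq_zero fun l hl => ?_
    have := h l (Finset.mem_range.1 hl)
    rw [aeval_polyOfVec] at this
    rw [← mul_zero (P.coeff l), ← this, Finset.mul_sum]
    exact Finset.sum_congr rfl fun i _ => by ring
  rw [Finset.sum_eq_single i₀] at hsum
  · have hy0 : y ≠ 0 := right_ne_zero_of_mul_eq_one hy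
    have hc0 : algebraMap F E (c i₀) ≠ 0 := by simpa using hi₀
    have hP0 : P.eval (β ^ (i₀ : ℕ)) ≠ 0 := by
      rw [hP, eval_prod, Finset.prod_ne_zero_iff]
      intro j hj
      rw [eval_sub, eval_X, eval_C, sub_ne_zero]
      intro hij
      exact (Finset.mem_erase.1 hj).1 (Fin.ext (hβ.pow_inj i₀.2 j.2 hij)).symm
    exact mul_ne_zero (mul_ne_zero hc0 (pow_ne_zero _ hy0)) hP0 hsum
  · intro i _ hi
    by_cases hci : c i = 0
    · simp [hci]
    · have : P.eval (β ^ (i : ℕ)) = 0 := by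
        rw [hP, eval_prod]
        exact Finset.prod_eq_zero (Finset.mem_erase.2 ⟨hi, by simpa [hS] using hci⟩) (by simp)
      simp [this]
  · simp

/-- The zeros of a polynomial over `𝔽_q` are stable under `x ↦ x ^ q ^ j`. -/
lemma aeval_pow_card_pow_eq_zero [Fintype F] {p : F[X]} {x : E} (h : aeval x p = 0) (j : ℕ) :
    aeval (x ^ Fintype.card F ^ j) p = 0 := by
  induction j with
  | zero => simpa using h
  | succ j ih =>
    rw [pow_succ, pow_mul, ← expand_aeval, FiniteField.expand_card, map_pow, ih,
      zero_pow Fintype.card_ne_zero]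

end CyclicCode

section TwoPowAddOne

lemma orderOf_four_zmod {m : ℕ} (hm : Odd m) (u : (ZMod (2 ^ m + 1))ˣ)
    (hu : (u : ZMod (2 ^ m + 1)) = 4) : orderOf u = m := by
  have hmod := Nat.odd_iff.1 hm
  have h2 : (2 : ZMod (2 ^ m + 1)) ^ m = -1 := by
    have := ZMod.natCast_self (2 ^ m + 1)
    push_cast at this
    exact eq_neg_of_add_eq_zero_left this
  have h4 : ∀ j, ((u ^ j : (ZMod (2 ^ m + 1))ˣ) : ZMod (2 ^ m + 1)) = 2 ^ (2 * j) := fun j => by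
    rw [Units.val_pow_eq_pow_val, hu, pow_mul]; norm_num
  refine (orderOf_eq_iff (by omega)).2 ⟨Units.ext ?_, fun j hj hj0 h => ?_⟩
  · rw [h4, mul_comm, pow_mul, h2]; simp
  · have h1 : (2 : ZMod (2 ^ m + 1)) ^ (2 * j) = 1 := by rw [← h4, h]; simp
    rcases lt_or_ge (2 * j) m with hlt | hge
    · have h3 : ((2 ^ (2 * j) - 1 : ℕ) : ZMod (2 ^ m + 1)) = 0 := by
        rw [Nat.cast_sub Nat.one_le_two_pow]; push_cast; rw [h1]; simp
      have h5 := Nat.le_of_dvd (Nat.sub_pos_of_lt (Nat.one_lt_two_pow (by omega)))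
        ((ZMod.natCast_eq_zero_iff _ _).1 h3)
      have := Nat.pow_lt_pow_right (a := 2) (by norm_num) hlt
      have := Nat.two_pow_pos (2 * j)
      omega
    · have h3 : ((2 ^ (2 * j - m) + 1 : ℕ) : ZMod (2 ^ m + 1)) = 0 := by
        push_cast
        have : (2 : ZMod (2 ^ m + 1)) ^ (2 * j) = 2 ^ m * 2 ^ (2 * j - m) := by
          rw [← pow_add]; congr 1; omega
        rw [h1, h2] at this
        linear_combination this
      have h5 := Nat.le_of_dvd (Nat.succ_pos _) ((ZMod.natCast_eq_zero_iff _ _).1 h3)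
      have := Nat.pow_lt_pow_right (a := 2) (by norm_num) (show 2 * j - m < m by omega)
      omega

variable {F : Type*} [Field F] [Fintype F] {E : Type*} [Field E] [Algebra F E]

lemma natDegree_minpoly_of_isPrimitiveRoot {t : ℕ} (hF : Fintype.card F = 4) {β : E}
    (hβ : IsPrimitiveRoot β (2 ^ (2 * t + 1) + 1)) :
    (minpoly F β).natDegree = 2 * t + 1 := by
  have : Fact (Nat.Prime 2) := ⟨Nat.prime_two⟩
  have hK : Fintype.card F = 2 ^ 2 := hF
  have : CharP F 2 := charP_of_card_eq_prime_pow hK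
  have : CharP E 2 := charP_of_injective_algebraMap (algebraMap F E).injective 2
  have hcop : Nat.Coprime 2 (2 ^ (2 * t + 1) + 1) := by
    rw [Nat.coprime_two_left]
    exact Even.add_one (Nat.even_pow.2 ⟨even_two, by omega⟩)
  have hne : NeZero ((2 ^ (2 * t + 1) + 1 : ℕ) : E) := ⟨by
    have h2 : (2 : E) = 0 := CharTwo.two_eq_zero
    push_cast
    rw [h2]; simp⟩
  have hint : IsIntegral F β := ⟨X ^ (2 ^ (2 * t + 1) + 1) - 1,
    monic_X_pow_sub_C 1 (Nat.succ_ne_zero _), by simp [hβ.pow_eq_one]⟩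
  rw [natDegree_of_dvd_cyclotomic_of_irreducible hK hcop (minpoly.dvd F β ?_)
    (minpoly.irreducible hint)]
  · refine orderOf_four_zmod (odd_two_mul_add_one t) _ ?_
    rw [ZMod.coe_unitOfCoprime]
    norm_num
  · rw [← eval_map_algebraMap, map_cyclotomic]
    exact (isRoot_cyclotomic_iff.2 hβ).eq_zero

lemma minpoly_sq_ne_minpoly {t : ℕ} (hF : Fintype.card F = 4) {β : E}
    (hβ : IsPrimitiveRoot β (2 ^ (2 * t + 1) + 1)) :
    minpoly F (β ^ 2) ≠ minpoly F β := by
  intro heq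
  have hdeg := natDegree_minpoly_of_isPrimitiveRoot hF hβ
  have hdvd : minpoly F β ∣ expand F 2 (minpoly F β) :=
    minpoly.dvd F β (by rw [expand_aeval, ← heq, minpoly.aeval])
  have hroot : ∀ j : ℕ, aeval (β ^ 2 ^ j) (minpoly F β) = 0 := fun j => by
    induction j with
    | zero => simp
    | succ j ih =>
      rw [pow_succ, pow_mul, ← expand_aeval]
      exact aeval_eq_zero_of_dvd_aeval_eq_zero hdvd ih
  have hzero : (minpoly F β).map (algebraMap F E) = 0 := by
    refine eq_zero_of_natDegree_lt_card_of_eval_eq_zero _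
      (f := fun i : Fin (2 * t + 2) => β ^ 2 ^ (i : ℕ)) (fun i j hij => ?_) (fun i => ?_) ?_
    · have hlt : ∀ i : Fin (2 * t + 2), 2 ^ (i : ℕ) < 2 ^ (2 * t + 1) + 1 := fun i =>
        Nat.lt_succ_of_le (Nat.pow_le_pow_right two_pos (Nat.lt_succ_iff.1 i.2))
      exact Fin.ext (Nat.pow_right_injective le_rfl (hβ.pow_inj (hlt i) (hlt j) hij))
    · rw [eval_map_algebraMap]; exact hroot i
    · rw [natDegree_map, hdeg, Fintype.card_fin]; omega
  rw [Polynomial.map_eq_zero] at hzero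
  simp [hzero] at hdeg

end TwoPowAddOne

/-- For `n = 2^{2t+1} + 1`, the quaternary cyclic code with generator
polynomial `lcm(m₀(x), m₁(x), m₂(x))` is a Hermitian LCD code of dimension
`2^{2t+1} − 4t − 2` and minimum distance at least `6`.  (The lcm of the distinct monic
irreducible minimal polynomials is their product over the set of distinct values.) -/
theorem stmt6 {t : ℕ} (ht : 1 ≤ t)
    {F : Type*} [Field F] [Fintype F] [DecidableEq F] (hF : Fintype.card F = 4)
    {E : Type*} [Field E] [Algebra F E] (β : E)
    (hβ : IsPrimitiveRoot β (2 ^ (2 * t + 1) + 1))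
    (g : Polynomial F)
    (hg : g = ∏ p ∈ (({0, 1, 2} : Finset ℕ).image fun i => minpoly F (β ^ i)), p) :
    IsHermitianLCD 2
        ((cyclicCodeOf (2 ^ (2 * t + 1) + 1) g :
          Submodule F (Fin (2 ^ (2 * t + 1) + 1) → F)) : Set (Fin (2 ^ (2 * t + 1) + 1) → F)) ∧
    (Module.finrank F (cyclicCodeOf (2 ^ (2 * t + 1) + 1) g) : ℤ)
        = 2 ^ (2 * t + 1) - 4 * t - 2 ∧
    ∀ c ∈ cyclicCodeOf (2 ^ (2 * t + 1) + 1) g, c ≠ 0 → 6 ≤ hammingNorm c := by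
  set n := 2 ^ (2 * t + 1) + 1 with hn
  have : Fact (Nat.Prime 2) := ⟨Nat.prime_two⟩
  have : CharP F 2 := charP_of_card_eq_prime_pow (f := 2) hF
  have : CharP E 2 := charP_of_injective_algebraMap (algebraMap F E).injective 2
  have hβn : β ^ n = 1 := hβ.pow_eq_one
  have hβ2 : IsPrimitiveRoot (β ^ 2) n := by
    refine hβ.pow_of_coprime 2 ?_
    rw [Nat.coprime_two_left]
    exact Even.add_one (Nat.even_pow.2 ⟨even_two, by omega⟩)
  have hint : ∀ i : ℕ, IsIntegral F (β ^ i) := fun i => IsIntegral.pow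
    ⟨X ^ n - 1, monic_X_pow_sub_C 1 (Nat.succ_ne_zero _), by simp [hβn]⟩ i
  have hdeg0 : (minpoly F (β ^ 0)).natDegree = 1 := by
    rw [pow_zero, minpoly.one, ← C_1, natDegree_X_sub_C]
  have hdeg1 : (minpoly F (β ^ 1)).natDegree = 2 * t + 1 := by
    rw [pow_one]; exact natDegree_minpoly_of_isPrimitiveRoot hF hβ
  have hdeg2 : (minpoly F (β ^ 2)).natDegree = 2 * t + 1 :=
    natDegree_minpoly_of_isPrimitiveRoot hF hβ2
  have hne01 : minpoly F (β ^ 0) ≠ minpoly F (β ^ 1) := fun h => by rw [h] at hdeg0; omega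
  have hne02 : minpoly F (β ^ 0) ≠ minpoly F (β ^ 2) := fun h => by rw [h] at hdeg0; omega
  have hne12 : minpoly F (β ^ 1) ≠ minpoly F (β ^ 2) := by
    rw [pow_one]; exact (minpoly_sq_ne_minpoly hF hβ).symm
  have hg' : g = minpoly F (β ^ 0) * (minpoly F (β ^ 1) * minpoly F (β ^ 2)) := by
    rw [hg, Finset.image_insert, Finset.image_insert, Finset.image_singleton,
      Finset.prod_insert (by simpa using ⟨by simpa using hne01, by simpa using hne02⟩),
      Finset.prod_insert (by simpa using hne12), Finset.prod_singleton]
  have hmonic : g.Monic := hg' ▸ (minpoly.monic (hint 0)).mul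
    ((minpoly.monic (hint 1)).mul (minpoly.monic (hint 2)))
  have hgdeg : g.natDegree = 4 * t + 3 := by
    rw [hg', (minpoly.monic (hint 0)).natDegree_mul
      ((minpoly.monic (hint 1)).mul (minpoly.monic (hint 2))),
      (minpoly.monic (hint 1)).natDegree_mul (minpoly.monic (hint 2)), hdeg0, hdeg1, hdeg2]
    ring
  have hcop : ∀ i j : ℕ, minpoly F (β ^ i) ≠ minpoly F (β ^ j) →
      IsCoprime (minpoly F (β ^ i)) (minpoly F (β ^ j)) := fun i j hij =>
    (minpoly.irreducible (hint i)).coprime_iff_not_dvd.2 fun hd => hij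
      (eq_of_monic_of_associated (minpoly.monic (hint i)) (minpoly.monic (hint j))
        ((minpoly.irreducible (hint i)).associated_of_dvd (minpoly.irreducible (hint j)) hd))
  have hdvd_iff : ∀ p : F[X], g ∣ p ↔
      aeval (β ^ 0) p = 0 ∧ aeval (β ^ 1) p = 0 ∧ aeval (β ^ 2) p = 0 := fun p => by
    rw [← minpoly.dvd_iff, ← minpoly.dvd_iff, ← minpoly.dvd_iff, hg']
    refine ⟨fun h => ⟨dvd_of_mul_right_dvd h, ?_, ?_⟩, fun h => ?_⟩
    · exact dvd_of_mul_right_dvd (dvd_of_mul_left_dvd h)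
    · exact dvd_of_mul_left_dvd (dvd_of_mul_left_dvd h)
    · exact (IsCoprime.mul_right (hcop 0 1 hne01) (hcop 0 2 hne02)).mul_dvd h.1
        ((hcop 1 2 hne12).mul_dvd h.2.1 h.2.2)
  have hgn : g.natDegree < n := by
    have key : ∀ t : ℕ, 1 ≤ t → 4 * t + 3 ≤ 2 ^ (2 * t + 1) := fun t ht => by
      induction t, ht using Nat.le_induction with
      | base => norm_num
      | succ k hk ih =>
        rw [show 2 * (k + 1) + 1 = 2 * k + 1 + 2 by ring, pow_add]
        omega
    have := key t ht
    omega
  have hpow_neg_two : ∀ x : E, x ^ n = 1 → x ^ 4 ^ (t + 1) * x ^ 2 = 1 := fun x hx => by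
    rw [← pow_add, show 4 ^ (t + 1) + 2 = n * 2 by
      rw [hn, show 4 = 2 ^ 2 by rfl, ← pow_mul]; ring, pow_mul, hx, one_pow]
  refine ⟨?_, ?_, ?_⟩
  · refine Set.Subset.antisymm ?_ ?_
    · rintro b ⟨hbC, hbD⟩
      rw [Set.mem_singleton_iff]
      refine eq_zero_of_forall_aeval_pow_eq_zero (Nat.succ_pos _) hβ b fun k _ => ?_
      set x := β ^ k with hx
      have hxn : x ^ n = 1 := by rw [hx, pow_right_comm, hβn, one_pow]
      set γ := x ^ 2 ^ (2 * t) with hγ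
      have hγn : γ ^ n = 1 := by rw [hγ, pow_right_comm, hxn, one_pow]
      have hxγ : x * γ ^ 2 = 1 := by
        rw [hγ, ← pow_mul, ← pow_succ', ← pow_succ, ← hn, hxn]
      have hγx : γ ^ 4 ^ (t + 1) = x := by
        have h0 : γ ^ 2 ≠ 0 := right_ne_zero_of_mul_eq_one hxγ
        exact mul_right_cancel₀ h0 ((hpow_neg_two γ hγn).trans hxγ.symm)
      have hgpoly : polyOfVec (fun i : Fin n => g.coeff i) = g :=
        polyOfVec_coeff ((natDegree_lt_iff_degree_lt hmonic.ne_zero).1 hgn)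
      have hmul := aeval_mul_aeval_sq_eq_zero hxn hxγ b (fun i : Fin n => g.coeff i) fun s => by
        refine hbD (fun i => g.coeff (i - s : Fin n)) ?_
        change g ∣ polyOfVec _
        have hself := (hdvd_iff g).1 dvd_rfl
        have hshift : ∀ i : ℕ, aeval (β ^ i) g = 0 →
            aeval (β ^ i) (polyOfVec fun j : Fin n => g.coeff (j - s : Fin n)) = 0 :=
          fun i hi => by
          have hi1 : (β ^ i) ^ n = 1 := by rw [pow_right_comm, hβn, one_pow]
          rw [aeval_polyOfVec_sub hi1 (fun j : Fin n => g.coeff j) s, hgpoly, hi, mul_zero]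
        exact (hdvd_iff _).2 ⟨hshift 0 hself.1, hshift 1 hself.2.1, hshift 2 hself.2.2⟩
      rcases mul_eq_zero.1 hmul with h | h
      · exact h
      · rw [hgpoly] at h
        have h' := aeval_pow_card_pow_eq_zero (pow_eq_zero_iff two_ne_zero |>.1 h) (t + 1)
        rw [hF, hγx] at h'
        exact aeval_eq_zero_of_dvd_aeval_eq_zero hbC h'
    · rintro _ rfl
      exact ⟨Submodule.zero_mem _, fun c _ => by simp⟩
  · have h := finrank_cyclicCodeOf_add_natDegree hmonic hgn.le
    rw [hgdeg, hn] at h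
    have h' : (Module.finrank F (cyclicCodeOf n g) : ℤ) + (4 * t + 3) = 2 ^ (2 * t + 1) + 1 := by
      exact_mod_cast h
    linarith
  · intro c hc hc0
    obtain ⟨h0, h1, h2⟩ := (hdvd_iff _).1 hc
    have hfrob : ∀ x : E, aeval x (polyOfVec c) = 0 → ∀ j, aeval (x ^ 4 ^ j) (polyOfVec c) = 0 :=
      fun x hx j => hF ▸ aeval_pow_card_pow_eq_zero hx j
    have hy : β ^ 2 * β ^ 4 ^ (t + 1) = 1 := by rw [mul_comm]; exact hpow_neg_two β hβn
    refine six_le_hammingNorm hβ hc0 hy fun l hl => ?_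
    interval_cases l
    · rw [pow_zero, mul_one]
      exact hfrob β (by simpa using h1) (t + 1)
    · have hinv : β ^ 4 ^ (t + 1) * β ^ 1 = (β ^ 2) ^ 4 ^ t := by
        rw [← pow_mul, ← pow_add, show 4 ^ (t + 1) + 1 = 2 * 4 ^ t + n by
          rw [hn, show 4 = 2 ^ 2 by rfl, ← pow_mul, ← pow_mul]; ring, pow_add, hβn, mul_one]
      rw [hinv]
      exact hfrob _ h2 t
    · rw [mul_comm, hy]; simpa using h0
    · rw [show β ^ 3 = β ^ 2 * β ^ 1 by ring, ← mul_assoc, mul_comm (β ^ _), hy, one_mul]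
      exact h1
    · rw [show β ^ 4 = β ^ 2 * β ^ 2 by ring, ← mul_assoc, mul_comm (β ^ _), hy, one_mul]
      exact h2
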